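/- arXiv:1304.6309 — 7 statements merged into one kernel-verified Lean document; each statement's English description precedes it below -/
import Mathlib

section
/- Under the stated assumptions, the sequential Holm procedure controls the type I familywise error rate: the probability that the procedure rejects the null hypothesis H^(i) for some index i in T (the set of true null hypotheses) at some stage is at most α. -/
open MeasureTheory Finset

/-- A realized sample path of the (standardized) sequential Holm procedure for `k` data
streams with statistics `Λ i n` (stream `i` at time `n ≥ 1`), lower stopping boundaries
`lo a` (when `a` hypotheses have been accepted so far) and upper stopping boundaries `hi r`
(when `r` hypotheses have been rejected so far).  Stages are indexed `j = 0, 1, …` (stage `j`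
of the structure is stage `j+1` of the informal description); `J` is the number of completed
stages, `t j` the cumulative sample size after `j` stages (`t 0 = 0`), `acc j`/`rej j` the
hypotheses accepted/rejected during the first `j` stages, `active j` the active hypotheses at
the beginning of stage `j+1`, and `ord j 0, ord j 1, …` enumerates the active hypotheses of
stage `j+1` in nondecreasing order of their statistics at the stage's stopping time (ties
broken arbitrarily). -/
structure HolmPath (k : ℕ) (lo hi : ℕ → ℝ) (Λ : Fin k → ℕ → ℝ) where
  /-- the number of completed stages -/
  J : ℕ
  /-- `t j` = cumulative sample size after `j` completed stages; `t 0 = 0` -/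
  t : ℕ → ℕ
  /-- hypotheses accepted during the first `j` stages -/
  acc : ℕ → Finset (Fin k)
  /-- hypotheses rejected during the first `j` stages -/
  rej : ℕ → Finset (Fin k)
  /-- hypotheses still active after `j` stages -/
  active : ℕ → Finset (Fin k)
  /-- `a j` = number of hypotheses accepted during the first `j` stages -/
  a : ℕ → ℕ
  /-- `r j` = number of hypotheses rejected during the first `j` stages -/
  r : ℕ → ℕ
  /-- `K j` = number of active hypotheses at the beginning of stage `j+1` -/
  K : ℕ → ℕ
  /-- `ord j` = ordering of the active statistics of stage `j+1` at its stopping time -/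
  ord : ℕ → ℕ → Fin k
  ht0 : t 0 = 0
  hacc0 : acc 0 = ∅
  hrej0 : rej 0 = ∅
  hactive : ∀ j, active j = Finset.univ \ (acc j ∪ rej j)
  ha : ∀ j, a j = (acc j).card
  hr : ∀ j, r j = (rej j).card
  hK : ∀ j, K j = (active j).card
  /-- each completed stage samples at least one new observation -/
  htmono : ∀ j < J, t j < t (j + 1)
  /-- sampling continues while every active statistic stays strictly between the bounds -/
  hcont : ∀ j < J, ∀ n, t j < n → n < t (j + 1) → ∀ i ∈ active j,
      lo (a j) < Λ i n ∧ Λ i n < hi (r j)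
  /-- at the stopping time of each completed stage, some active statistic leaves the open
      interval `(lo (a j), hi (r j))` -/
  hcross : ∀ j < J, ∃ i ∈ active j,
      Λ i (t (j + 1)) ≤ lo (a j) ∨ hi (r j) ≤ Λ i (t (j + 1))
  hord_mem : ∀ j < J, ∀ p < K j, ord j p ∈ active j
  hord_inj : ∀ j < J, ∀ p < K j, ∀ q < K j, ord j p = ord j q → p = q
  hord_mono : ∀ j < J, ∀ p q, p ≤ q → q < K j →
      Λ (ord j p) (t (j + 1)) ≤ Λ (ord j q) (t (j + 1))
  /-- if the lower boundary is crossed, the hypotheses with the `m` smallest ordered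
      statistics are accepted, where `m = min{m ≥ 1 : x_{m+1} > lo (a j + m)}` with the
      convention `x_{K+1} = +∞` (here `x_{p+1} = Λ (ord j p) (t (j+1))`) -/
  haccept : ∀ j < J, (∃ i ∈ active j, Λ i (t (j + 1)) ≤ lo (a j)) →
      ∃ m, 1 ≤ m ∧ m ≤ K j ∧
        (m = K j ∨ lo (a j + m) < Λ (ord j m) (t (j + 1))) ∧
        (∀ m', 1 ≤ m' → m' < m →
          ¬(m' = K j ∨ lo (a j + m') < Λ (ord j m') (t (j + 1)))) ∧
        acc (j + 1) = acc j ∪ (Finset.range m).image (ord j)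
  hnoaccept : ∀ j < J, (¬ ∃ i ∈ active j, Λ i (t (j + 1)) ≤ lo (a j)) →
      acc (j + 1) = acc j
  /-- if the upper boundary is crossed, the hypotheses with the `m` largest ordered
      statistics are rejected, where `m = min{m ≥ 1 : x_{K−m} < hi (r j + m)}` with the
      convention `x₀ = −∞` -/
  hreject : ∀ j < J, (∃ i ∈ active j, hi (r j) ≤ Λ i (t (j + 1))) →
      ∃ m, 1 ≤ m ∧ m ≤ K j ∧
        (m = K j ∨ Λ (ord j (K j - m - 1)) (t (j + 1)) < hi (r j + m)) ∧
        (∀ m', 1 ≤ m' → m' < m →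
          ¬(m' = K j ∨ Λ (ord j (K j - m' - 1)) (t (j + 1)) < hi (r j + m'))) ∧
        rej (j + 1) = rej j ∪ (Finset.Ico (K j - m) (K j)).image (ord j)
  hnoreject : ∀ j < J, (¬ ∃ i ∈ active j, hi (r j) ≤ Λ i (t (j + 1))) →
      rej (j + 1) = rej j
  /-- after the last completed stage, either every hypothesis has been decided, or the
      remaining active statistics never leave the open interval again (so no further
      decisions are ever made) -/
  hfinal : active J = ∅ ∨
      ∀ n, t J < n → ∀ i ∈ active J, lo (a J) < Λ i n ∧ Λ i n < hi (r J)

theorem holm_surj {k : ℕ} {lo hi : ℕ → ℝ} {Λ : Fin k → ℕ → ℝ} (h : HolmPath k lo hi Λ)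
    (j : ℕ) (hj : j < h.J) (i : Fin k) (hi' : i ∈ h.active j) :
    ∃ p < h.K j, h.ord j p = i := by
  have hsub : (Finset.range (h.K j)).image (h.ord j) ⊆ h.active j := by
    intro x hx
    simp only [Finset.mem_image, Finset.mem_range] at hx
    obtain ⟨p, hp, rfl⟩ := hx
    exact h.hord_mem j hj p hp
  have hcard : ((Finset.range (h.K j)).image (h.ord j)).card = h.K j := by
    rw [Finset.card_image_of_injOn, Finset.card_range]
    intro p hp q hq hpq
    simp only [Finset.coe_range, Set.mem_Iio] at hp hq
    exact h.hord_inj j hj p hp q hq hpq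
  have heq := Finset.eq_of_subset_of_card_le hsub (by rw [hcard, h.hK])
  rw [← heq] at hi'
  simpa using hi'

theorem holm_acc_mono {k : ℕ} {lo hi : ℕ → ℝ} {Λ : Fin k → ℕ → ℝ} (h : HolmPath k lo hi Λ)
    (j : ℕ) (hj : j < h.J) : h.acc j ⊆ h.acc (j+1) := by
  by_cases hc : ∃ i ∈ h.active j, Λ i (h.t (j + 1)) ≤ lo (h.a j)
  · obtain ⟨m, -, -, -, -, he⟩ := h.haccept j hj hc
    rw [he]; exact Finset.subset_union_left
  · rw [h.hnoaccept j hj hc]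

theorem holm_rej_mono {k : ℕ} {lo hi : ℕ → ℝ} {Λ : Fin k → ℕ → ℝ} (h : HolmPath k lo hi Λ)
    (j : ℕ) (hj : j < h.J) : h.rej j ⊆ h.rej (j+1) := by
  by_cases hc : ∃ i ∈ h.active j, hi (h.r j) ≤ Λ i (h.t (j + 1))
  · obtain ⟨m, -, -, -, -, he⟩ := h.hreject j hj hc
    rw [he]; exact Finset.subset_union_left
  · rw [h.hnoreject j hj hc]

theorem holm_stay {k : ℕ} {Λ : Fin k → ℕ → ℝ}
    (h : HolmPath k (fun a => -((k : ℝ) - a)) (fun r => (k : ℝ) - r) Λ) (i : Fin k) :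
    ∀ j, j ≤ h.J → i ∈ h.active j → ∀ n, 1 ≤ n → n ≤ h.t j → -(k : ℝ) < Λ i n := by
  intro j
  induction j with
  | zero => intro _ _ n h1 h2; rw [h.ht0] at h2; omega
  | succ j ih =>
    intro hj hact n h1 h2
    have hj' : j < h.J := hj
    have hnot : i ∉ h.acc (j+1) ∧ i ∉ h.rej (j+1) := by
      rw [h.hactive] at hact; simpa using hact
    have hact' : i ∈ h.active j := by
      rw [h.hactive]
      have ha := fun hh => hnot.1 (holm_acc_mono h j hj' hh)
      have hr := fun hh => hnot.2 (holm_rej_mono h j hj' hh)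
      simpa using ⟨ha, hr⟩
    rcases Nat.lt_or_ge (h.t j) n with hlt | hge
    · rcases Nat.lt_or_ge n (h.t (j+1)) with hlt2 | hge2
      · have := (h.hcont j hj' n hlt hlt2 i hact').1
        have h0 : (0:ℝ) ≤ (h.a j : ℝ) := Nat.cast_nonneg _
        linarith
      · have hn : n = h.t (j+1) := le_antisymm h2 hge2
        subst hn
        by_cases hc : ∃ i ∈ h.active j, Λ i (h.t (j + 1)) ≤ -((k:ℝ) - (h.a j : ℝ))
        · obtain ⟨m, hm1, hmK, hm, -, he⟩ := h.haccept j hj' hc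
          obtain ⟨p, hp, rfl⟩ := holm_surj h j hj' i hact'
          have hmp : m ≤ p := by
            by_contra hlt
            apply hnot.1
            rw [he]
            apply Finset.mem_union_right
            exact Finset.mem_image_of_mem _ (Finset.mem_range.2 (by omega))
          have h3 := hm.resolve_left (by omega)
          have h4 := h.hord_mono j hj' m p hmp hp
          have h0 : (0:ℝ) ≤ ((h.a j + m : ℕ) : ℝ) := Nat.cast_nonneg _
          linarith
        · push Not at hc
          have := hc i hact'
          have h0 : (0:ℝ) ≤ (h.a j : ℝ) := Nat.cast_nonneg _
          linarith
    · exact ih hj'.le hact' n h1 hge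

theorem holm_key {k : ℕ} {Λ : Fin k → ℕ → ℝ}
    (h : HolmPath k (fun a => -((k : ℝ) - a)) (fun r => (k : ℝ) - r) Λ) (T : Finset (Fin k)) :
    ∀ j, j ≤ h.J → (∃ i ∈ T, i ∈ h.rej j) →
      ∃ i ∈ T, ∃ n, 1 ≤ n ∧ (T.card : ℝ) ≤ Λ i n ∧ ∀ n', 1 ≤ n' → n' < n → -(k : ℝ) < Λ i n' := by
  intro j
  induction j with
  | zero => rintro _ ⟨i, _, hi⟩; rw [h.hrej0] at hi; simp at hi
  | succ j ih =>
    rintro hj ⟨i, hiT, hirej⟩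
    have hj' : j < h.J := hj
    by_cases hprev : ∃ i ∈ T, i ∈ h.rej j
    · exact ih hj'.le hprev
    by_cases hc : ∃ i ∈ h.active j, (k:ℝ) - (h.r j : ℝ) ≤ Λ i (h.t (j + 1))
    swap
    · rw [h.hnoreject j hj' hc] at hirej
      exact absurd ⟨i, hiT, hirej⟩ hprev
    obtain ⟨m, hm1, hmK, -, hmin, he⟩ := h.hreject j hj' hc
    -- the largest position with index in T
    have hex : ∃ d, d < m ∧ h.ord j (h.K j - 1 - d) ∈ T := by
      rw [he, Finset.mem_union] at hirej
      rcases hirej with hh | hh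
      · exact absurd ⟨i, hiT, hh⟩ hprev
      · simp only [Finset.mem_image, Finset.mem_Ico] at hh
        obtain ⟨p, ⟨hp1, hp2⟩, rfl⟩ := hh
        refine ⟨h.K j - 1 - p, by omega, ?_⟩
        rwa [show h.K j - 1 - (h.K j - 1 - p) = p by omega]
    classical
    obtain ⟨hdm, hdT⟩ := Nat.find_spec hex
    have hdmin := fun d' => @Nat.find_min _ _ hex d'
    generalize Nat.find hex = d at hdm hdT hdmin
    have hactd := h.hord_mem j hj' (h.K j - 1 - d) (by omega)
    refine ⟨_, hdT, h.t (j+1), ?_, ?_, ?_⟩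
    · have := h.htmono j hj'; omega
    · -- counting
      have hcount : T.card + h.r j + d ≤ k := by
        let U := (Finset.range d).image (fun e => h.ord j (h.K j - 1 - e))
        have hU : U.card = d := by
          rw [Finset.card_image_of_injOn, Finset.card_range]
          intro p hp q hq hpq
          simp only [Finset.coe_range, Set.mem_Iio] at hp hq
          have := h.hord_inj j hj' _ (by omega) _ (by omega) hpq
          omega
        have hTr : Disjoint T (h.rej j) := by
          rw [Finset.disjoint_left]
          intro x hx hx'
          exact hprev ⟨x, hx, hx'⟩
        have hUd : Disjoint (T ∪ h.rej j) U := by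
          rw [Finset.disjoint_right]
          intro x hx hx'
          simp only [U, Finset.mem_image, Finset.mem_range] at hx
          obtain ⟨e, hed, rfl⟩ := hx
          rcases Finset.mem_union.1 hx' with hh | hh
          · exact hdmin e hed ⟨by omega, hh⟩
          · have := h.hord_mem j hj' (h.K j - 1 - e) (by omega)
            rw [h.hactive] at this
            simp [hh] at this
        have := Finset.card_le_univ ((T ∪ h.rej j) ∪ U)
        rw [Finset.card_union_of_disjoint hUd, Finset.card_union_of_disjoint hTr, hU,
          Fintype.card_fin, ← h.hr] at this
        exact this
      have hcount' : (T.card : ℝ) + h.r j + d ≤ k := by exact_mod_cast hcount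
      rcases Nat.eq_zero_or_pos d with rfl | hd
      · obtain ⟨x, hx, hxl⟩ := hc
        obtain ⟨p, hp, rfl⟩ := holm_surj h j hj' x hx
        have := h.hord_mono j hj' p (h.K j - 1 - 0) (by omega) (by omega)
        simp only [Nat.cast_zero] at hcount'
        linarith
      · have := hmin d hd hdm
        push Not at this
        have h2 := this.2
        rw [show h.K j - d - 1 = h.K j - 1 - d by omega] at h2
        push_cast at h2
        linarith
    · intro n h1 h2
      rcases Nat.lt_or_ge (h.t j) n with hlt | hge
      · have := (h.hcont j hj' n hlt h2 _ hactd).1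
        have h0 : (0:ℝ) ≤ (h.a j : ℝ) := Nat.cast_nonneg _
        linarith
      · exact holm_stay h _ j hj'.le hactd n h1 hge

/-- The sequential Holm procedure controls the type I familywise error rate: if `k ≥ 2`,
`α, β ∈ (0,1)`, the standardized statistics `Λ̃ i n` of the streams with true null hypotheses
(`i ∈ T`) satisfy `P(∃n: Λ̃ i n ≥ s, Λ̃ i n′ > −k ∀n′ < n) ≤ α/s` for all `s ∈ {1,…,k}`, and
those with false null hypotheses (`i ∈ F`) satisfy
`P(∃n: Λ̃ i n ≤ −s, Λ̃ i n′ < k ∀n′ < n) ≤ β/s` for all `s ∈ {1,…,k}`, then the probability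
that the sequential Holm procedure (with boundaries `−(k−a)` and `k−r`) rejects the null
hypothesis `H⁽ⁱ⁾` for some `i ∈ T` at some stage is at most `α`. -/
theorem seqHolm_FWER_I {Ω : Type*} [MeasurableSpace Ω]
    (P : Measure Ω) [IsProbabilityMeasure P]
    (k : ℕ) (hk : 2 ≤ k) (α β : ℝ)
    (hα : α ∈ Set.Ioo (0 : ℝ) 1) (hβ : β ∈ Set.Ioo (0 : ℝ) 1)
    (Λ : Fin k → ℕ → Ω → ℝ) (hmeas : ∀ i n, Measurable (Λ i n))
    (T F : Finset (Fin k)) (hTF : Disjoint T F)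
    (hI : ∀ i ∈ T, ∀ s : ℕ, 1 ≤ s → s ≤ k →
      P {ω | ∃ n, 1 ≤ n ∧ (s : ℝ) ≤ Λ i n ω ∧
          ∀ n', 1 ≤ n' → n' < n → -(k : ℝ) < Λ i n' ω} ≤ ENNReal.ofReal (α / s))
    (hII : ∀ i ∈ F, ∀ s : ℕ, 1 ≤ s → s ≤ k →
      P {ω | ∃ n, 1 ≤ n ∧ Λ i n ω ≤ -(s : ℝ) ∧
          ∀ n', 1 ≤ n' → n' < n → Λ i n' ω < (k : ℝ)} ≤ ENNReal.ofReal (β / s))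
    (run : ∀ ω : Ω, HolmPath k (fun a => -((k : ℝ) - a)) (fun r => (k : ℝ) - r)
      (fun i n => Λ i n ω)) :
    P {ω | ∃ i ∈ T, i ∈ (run ω).rej (run ω).J} ≤ ENNReal.ofReal α := by
  have hsub : {ω | ∃ i ∈ T, i ∈ (run ω).rej (run ω).J} ⊆
      ⋃ i ∈ T, {ω | ∃ n, 1 ≤ n ∧ (T.card : ℝ) ≤ Λ i n ω ∧
          ∀ n', 1 ≤ n' → n' < n → -(k : ℝ) < Λ i n' ω} := by
    intro ω hω
    obtain ⟨i, hi, hh⟩ := holm_key (run ω) T _ le_rfl hω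
    simp only [Set.mem_iUnion]
    exact ⟨i, hi, hh⟩
  rcases T.eq_empty_or_nonempty with rfl | hT
  · simp
  have hpos : 0 < T.card := hT.card_pos
  have hle : T.card ≤ k := by simpa using Finset.card_le_univ T
  calc P _ ≤ P _ := measure_mono hsub
    _ ≤ ∑ i ∈ T, P {ω | ∃ n, 1 ≤ n ∧ (T.card : ℝ) ≤ Λ i n ω ∧
          ∀ n', 1 ≤ n' → n' < n → -(k : ℝ) < Λ i n' ω} := measure_biUnion_finset_le _ _
    _ ≤ ∑ i ∈ T, ENNReal.ofReal (α / T.card) :=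
        Finset.sum_le_sum (fun i hi => hI i hi _ hpos hle)
    _ = ENNReal.ofReal α := by
        rw [Finset.sum_const, nsmul_eq_mul, ← ENNReal.ofReal_natCast,
          ← ENNReal.ofReal_mul (by positivity)]
        congr 1
        field_simp
end

section
/- Under the stated assumptions, the sequential Holm procedure controls the type II familywise error rate: the probability that the procedure accepts the null hypothesis H^(i) for some index i in F (the set of false null hypotheses) at some stage is at most β. -/
open MeasureTheory Finset

theorem HolmPath.acc_mono_step {k : ℕ} {lo hi : ℕ → ℝ} {Λ : Fin k → ℕ → ℝ}
    (h : HolmPath k lo hi Λ) (j : ℕ) (hj : j < h.J) : h.acc j ⊆ h.acc (j + 1) := by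
  by_cases hc : ∃ i ∈ h.active j, Λ i (h.t (j + 1)) ≤ lo (h.a j)
  · obtain ⟨m, -, -, -, -, e⟩ := h.haccept j hj hc
    rw [e]; exact Finset.subset_union_left
  · rw [h.hnoaccept j hj hc]

theorem HolmPath.rej_mono_step {k : ℕ} {lo hi : ℕ → ℝ} {Λ : Fin k → ℕ → ℝ}
    (h : HolmPath k lo hi Λ) (j : ℕ) (hj : j < h.J) : h.rej j ⊆ h.rej (j + 1) := by
  by_cases hc : ∃ i ∈ h.active j, hi (h.r j) ≤ Λ i (h.t (j + 1))
  · obtain ⟨m, -, -, -, -, e⟩ := h.hreject j hj hc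
    rw [e]; exact Finset.subset_union_left
  · rw [h.hnoreject j hj hc]

theorem HolmPath.active_anti_step {k : ℕ} {lo hi : ℕ → ℝ} {Λ : Fin k → ℕ → ℝ}
    (h : HolmPath k lo hi Λ) (j : ℕ) (hj : j < h.J) : h.active (j + 1) ⊆ h.active j := by
  rw [h.hactive, h.hactive]
  exact Finset.sdiff_subset_sdiff (Finset.Subset.refl _)
    (Finset.union_subset_union (h.acc_mono_step j hj) (h.rej_mono_step j hj))

theorem HolmPath.ord_surj {k : ℕ} {lo hi : ℕ → ℝ} {Λ : Fin k → ℕ → ℝ}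
    (h : HolmPath k lo hi Λ) (j : ℕ) (hj : j < h.J) (i : Fin k) (hi' : i ∈ h.active j) :
    ∃ q < h.K j, h.ord j q = i := by
  have e : (Finset.range (h.K j)).image (h.ord j) = h.active j := by
    apply Finset.eq_of_subset_of_card_le
    · intro x hx
      simp only [Finset.mem_image, Finset.mem_range] at hx
      obtain ⟨q, hq, rfl⟩ := hx
      exact h.hord_mem j hj q hq
    · rw [Finset.card_image_of_injOn, Finset.card_range, h.hK]
      intro p hp q hq hpq
      exact h.hord_inj j hj p (by simpa using hp) q (by simpa using hq) hpq
  rw [← e] at hi'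
  simpa only [Finset.mem_image, Finset.mem_range] using hi'

theorem HolmPath.lt_of_active {k : ℕ} {lo : ℕ → ℝ} {Λ : Fin k → ℕ → ℝ}
    (h : HolmPath k lo (fun r => (k : ℝ) - r) Λ) (j : ℕ) (i : Fin k) :
    j ≤ h.J → i ∈ h.active j → ∀ n, 1 ≤ n → n ≤ h.t j → Λ i n < k := by
  induction j with
  | zero => intro _ _ n h1 h2; rw [h.ht0] at h2; omega
  | succ j ih =>
    intro hj hact n h1 h2
    have hact' := h.active_anti_step j hj hact
    rcases Nat.lt_or_ge (h.t j) n with h3 | h3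
    · rcases Nat.lt_or_ge n (h.t (j + 1)) with h4 | h4
      · have := (h.hcont j hj n h3 h4 i hact').2
        have h5 : (0 : ℝ) ≤ (h.r j : ℝ) := Nat.cast_nonneg _
        linarith
      · obtain rfl : n = h.t (j + 1) := by omega
        by_contra hge
        have h5 : (0 : ℝ) ≤ (h.r j : ℝ) := Nat.cast_nonneg _
        obtain ⟨m, hm1, hm2, hm3, -, e⟩ := h.hreject j hj ⟨i, hact', by linarith⟩
        obtain ⟨q, hq, rfl⟩ := h.ord_surj j hj i hact'
        have hnr : h.ord j q ∉ h.rej (j + 1) := by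
          rw [h.hactive] at hact
          simp only [Finset.mem_sdiff, Finset.mem_union, not_or] at hact
          exact hact.2.2
        apply hnr
        rw [e]
        apply Finset.mem_union_right
        apply Finset.mem_image_of_mem
        rw [Finset.mem_Ico]
        refine ⟨?_, hq⟩
        by_contra hlt
        rcases hm3 with hm3 | hm3
        · omega
        · have := h.hord_mono j hj q (h.K j - m - 1) (by omega) (by omega)
          push_cast at hm3
          have h6 : (0 : ℝ) ≤ (m : ℝ) := Nat.cast_nonneg _
          linarith
    · exact ih (by omega) hact' n h1 h3

theorem HolmPath.exists_bad {k : ℕ} {Λ : Fin k → ℕ → ℝ}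
    (h : HolmPath k (fun a => -((k : ℝ) - a)) (fun r => (k : ℝ) - r) Λ)
    (F : Finset (Fin k)) (hF : ∃ i ∈ F, i ∈ h.acc h.J) :
    ∃ i ∈ F, ∃ n, 1 ≤ n ∧ Λ i n ≤ -(F.card : ℝ) ∧ ∀ n', 1 ≤ n' → n' < n → Λ i n' < (k : ℝ) := by
  classical
  have hex : ∃ j, j ≤ h.J ∧ ∃ i ∈ F, i ∈ h.acc j := ⟨h.J, le_rfl, hF⟩
  obtain ⟨j, ⟨hj, i₀, hi₀, hi₀a⟩, hmin⟩ :
      ∃ j, (j ≤ h.J ∧ ∃ i ∈ F, i ∈ h.acc j) ∧ ∀ l < j, ¬ (l ≤ h.J ∧ ∃ i ∈ F, i ∈ h.acc l) :=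
    ⟨Nat.find hex, Nat.find_spec hex, fun l hl => Nat.find_min hex hl⟩
  obtain _ | j := j
  · rw [h.hacc0] at hi₀a; simp at hi₀a
  have hno : ∀ i ∈ F, i ∉ h.acc j := fun i hi hia =>
    hmin j (by omega) ⟨by omega, i, hi, hia⟩
  by_cases hc : ∃ i ∈ h.active j, Λ i (h.t (j + 1)) ≤ (fun a : ℕ => -((k : ℝ) - a)) (h.a j)
  swap
  · rw [h.hnoaccept j hj hc] at hi₀a
    exact absurd hi₀a (hno _ hi₀)
  obtain ⟨m, hm1, hm2, -, hm4, e⟩ := h.haccept j hj hc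
  have hex2 : ∃ p, p < m ∧ h.ord j p ∈ F := by
    rw [e] at hi₀a
    rcases Finset.mem_union.1 hi₀a with h1 | h1
    · exact absurd h1 (hno _ hi₀)
    · simp only [Finset.mem_image, Finset.mem_range] at h1
      obtain ⟨p, hp, rfl⟩ := h1
      exact ⟨p, hp, hi₀⟩
  obtain ⟨p, ⟨hpm, hpF⟩, hpmin⟩ :
      ∃ p, (p < m ∧ h.ord j p ∈ F) ∧ ∀ q < p, ¬ (q < m ∧ h.ord j q ∈ F) :=
    ⟨Nat.find hex2, Nat.find_spec hex2, fun l hl => Nat.find_min hex2 hl⟩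
  have hcard : h.a j + p + F.card ≤ k := by
    have hd1 : Disjoint (h.acc j) ((Finset.range p).image (h.ord j)) := by
      rw [Finset.disjoint_right]
      intro x hx
      simp only [Finset.mem_image, Finset.mem_range] at hx
      obtain ⟨q, hq, rfl⟩ := hx
      have := h.hord_mem j hj q (by omega)
      rw [h.hactive] at this
      simp only [Finset.mem_sdiff, Finset.mem_union, not_or] at this
      exact this.2.1
    have hd2 : Disjoint (h.acc j ∪ (Finset.range p).image (h.ord j)) F := by
      rw [Finset.disjoint_right]
      intro x hx hx'
      rcases Finset.mem_union.1 hx' with h1 | h1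
      · exact hno _ hx h1
      · simp only [Finset.mem_image, Finset.mem_range] at h1
        obtain ⟨q, hq, rfl⟩ := h1
        exact hpmin q hq ⟨by omega, hx⟩
    have h1 := Finset.card_le_univ ((h.acc j ∪ (Finset.range p).image (h.ord j)) ∪ F)
    rw [Finset.card_union_of_disjoint hd2, Finset.card_union_of_disjoint hd1,
      Finset.card_image_of_injOn, Finset.card_range, Fintype.card_fin, ← h.ha] at h1
    · exact h1
    · intro x hx y hy hxy
      simp only [Finset.coe_range, Set.mem_Iio] at hx hy
      exact h.hord_inj j hj x (by omega) y (by omega) hxy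
  have hcardR : (h.a j : ℝ) + p + F.card ≤ k := by exact_mod_cast hcard
  have hact := h.hord_mem j hj p (by omega)
  refine ⟨h.ord j p, hpF, h.t (j + 1), ?_, ?_, ?_⟩
  · have := h.htmono j hj; omega
  · rcases Nat.eq_zero_or_pos p with hp | hp
    · subst hp
      obtain ⟨i, hia, hil⟩ := hc
      obtain ⟨q, hq, rfl⟩ := h.ord_surj j hj i hia
      have := h.hord_mono j hj 0 q (by omega) hq
      simp only at hil
      push_cast at hcardR
      linarith
    · have := hm4 p hp hpm
      rw [not_or, not_lt] at this
      have h2 := this.2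
      push_cast at h2
      linarith
  · intro n' h1 h2
    rcases Nat.lt_or_ge (h.t j) n' with h3 | h3
    · have := (h.hcont j hj n' h3 h2 _ hact).2
      have h5 : (0 : ℝ) ≤ (h.r j : ℝ) := Nat.cast_nonneg _
      linarith
    · exact h.lt_of_active j _ (by omega) hact n' h1 h3

/-- The sequential Holm procedure controls the type II familywise error rate: if `k ≥ 2`,
`α, β ∈ (0,1)`, the standardized statistics `Λ̃ i n` of the streams with true null hypotheses
(`i ∈ T`) satisfy `P(∃n: Λ̃ i n ≥ s, Λ̃ i n′ > −k ∀n′ < n) ≤ α/s` for all `s ∈ {1,…,k}`, and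
those with false null hypotheses (`i ∈ F`) satisfy
`P(∃n: Λ̃ i n ≤ −s, Λ̃ i n′ < k ∀n′ < n) ≤ β/s` for all `s ∈ {1,…,k}`, then the probability
that the sequential Holm procedure (with boundaries `−(k−a)` and `k−r`) accepts the null
hypothesis `H⁽ⁱ⁾` for some `i ∈ F` at some stage is at most `β`. -/
theorem seqHolm_FWER_II {Ω : Type*} [MeasurableSpace Ω]
    (P : Measure Ω) [IsProbabilityMeasure P]
    (k : ℕ) (hk : 2 ≤ k) (α β : ℝ)
    (hα : α ∈ Set.Ioo (0 : ℝ) 1) (hβ : β ∈ Set.Ioo (0 : ℝ) 1)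
    (Λ : Fin k → ℕ → Ω → ℝ) (hmeas : ∀ i n, Measurable (Λ i n))
    (T F : Finset (Fin k)) (hTF : Disjoint T F)
    (hI : ∀ i ∈ T, ∀ s : ℕ, 1 ≤ s → s ≤ k →
      P {ω | ∃ n, 1 ≤ n ∧ (s : ℝ) ≤ Λ i n ω ∧
          ∀ n', 1 ≤ n' → n' < n → -(k : ℝ) < Λ i n' ω} ≤ ENNReal.ofReal (α / s))
    (hII : ∀ i ∈ F, ∀ s : ℕ, 1 ≤ s → s ≤ k →
      P {ω | ∃ n, 1 ≤ n ∧ Λ i n ω ≤ -(s : ℝ) ∧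
          ∀ n', 1 ≤ n' → n' < n → Λ i n' ω < (k : ℝ)} ≤ ENNReal.ofReal (β / s))
    (run : ∀ ω : Ω, HolmPath k (fun a => -((k : ℝ) - a)) (fun r => (k : ℝ) - r)
      (fun i n => Λ i n ω)) :
    P {ω | ∃ i ∈ F, i ∈ (run ω).acc (run ω).J} ≤ ENNReal.ofReal β := by
  rcases F.eq_empty_or_nonempty with rfl | hne
  · simp
  have hpos : 0 < F.card := hne.card_pos
  have hle : F.card ≤ k := by simpa using Finset.card_le_univ F
  calc P {ω | ∃ i ∈ F, i ∈ (run ω).acc (run ω).J}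
      ≤ P (⋃ i ∈ F, {ω | ∃ n, 1 ≤ n ∧ Λ i n ω ≤ -(F.card : ℝ) ∧
          ∀ n', 1 ≤ n' → n' < n → Λ i n' ω < (k : ℝ)}) := by
        apply measure_mono
        intro ω hω
        simp only [Set.mem_iUnion]
        obtain ⟨i, hi, hn⟩ := (run ω).exists_bad F hω
        exact ⟨i, hi, hn⟩
    _ ≤ ∑ i ∈ F, P {ω | ∃ n, 1 ≤ n ∧ Λ i n ω ≤ -(F.card : ℝ) ∧
          ∀ n', 1 ≤ n' → n' < n → Λ i n' ω < (k : ℝ)} := measure_biUnion_finset_le _ _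
    _ ≤ ∑ i ∈ F, ENNReal.ofReal (β / F.card) :=
        Finset.sum_le_sum fun i hi => hII i hi F.card hpos hle
    _ = ENNReal.ofReal β := by
        rw [Finset.sum_const, nsmul_eq_mul, ← ENNReal.ofReal_natCast,
          ← ENNReal.ofReal_mul (Nat.cast_nonneg _)]
        congr 1
        have : (F.card : ℝ) ≠ 0 := by positivity
        field_simp
end

section
/- Under the stated assumptions with a common set of critical values for all streams, the unstandardized sequential Holm procedure controls both familywise error rates: the probability that it rejects H^(i) for some i ∈ T is at most α, and the probability that it accepts H^(i) for some i ∈ F is at most β. -/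
open MeasureTheory Finset

theorem HolmPath.exists_ord {k : ℕ} {lo hi : ℕ → ℝ} {Λ : Fin k → ℕ → ℝ}
    (h : HolmPath k lo hi Λ) {j : ℕ} (hj : j < h.J) {i : Fin k} (hi' : i ∈ h.active j) :
    ∃ p, p < h.K j ∧ h.ord j p = i := by
  have hinj : Set.InjOn (h.ord j) (Finset.range (h.K j) : Set ℕ) := by
    intro p hp q hq e
    simp at hp hq
    exact h.hord_inj j hj p hp q hq e
  have hsub : (Finset.range (h.K j)).image (h.ord j) ⊆ h.active j := by
    intro x hx
    simp only [Finset.mem_image, Finset.mem_range] at hx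
    obtain ⟨p, hp, rfl⟩ := hx
    exact h.hord_mem j hj p hp
  have heq := Finset.eq_of_subset_of_card_le hsub (by
    rw [Finset.card_image_of_injOn hinj, Finset.card_range, h.hK j])
  rw [← heq] at hi'
  simpa only [Finset.mem_image, Finset.mem_range] using hi'

theorem HolmPath.acc_sub {k : ℕ} {lo hi : ℕ → ℝ} {Λ : Fin k → ℕ → ℝ}
    (h : HolmPath k lo hi Λ) {j : ℕ} (hj : j < h.J) : h.acc j ⊆ h.acc (j + 1) := by
  by_cases hc : ∃ i ∈ h.active j, Λ i (h.t (j + 1)) ≤ lo (h.a j)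
  · obtain ⟨m, _, _, _, _, e⟩ := h.haccept j hj hc
    rw [e]; exact Finset.subset_union_left
  · rw [h.hnoaccept j hj hc]

theorem HolmPath.rej_sub {k : ℕ} {lo hi : ℕ → ℝ} {Λ : Fin k → ℕ → ℝ}
    (h : HolmPath k lo hi Λ) {j : ℕ} (hj : j < h.J) : h.rej j ⊆ h.rej (j + 1) := by
  by_cases hc : ∃ i ∈ h.active j, hi (h.r j) ≤ Λ i (h.t (j + 1))
  · obtain ⟨m, _, _, _, _, e⟩ := h.hreject j hj hc
    rw [e]; exact Finset.subset_union_left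
  · rw [h.hnoreject j hj hc]

theorem HolmPath.active_lower {k : ℕ} {lo hi : ℕ → ℝ} {Λ : Fin k → ℕ → ℝ}
    (h : HolmPath k lo hi Λ) (L : ℝ) (hL : ∀ a, L ≤ lo a) (j : ℕ) (hj : j ≤ h.J) :
    ∀ i ∈ h.active j, ∀ n, 1 ≤ n → n ≤ h.t j → L < Λ i n := by
  induction j with
  | zero =>
    intro i _ n h1 h2
    rw [h.ht0] at h2; omega
  | succ j ih =>
    intro i hia n h1 h2
    have hjJ : j < h.J := hj
    rw [h.hactive] at hia
    simp only [Finset.mem_sdiff, Finset.mem_univ, true_and, Finset.mem_union, not_or] at hia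
    have hij : i ∈ h.active j := by
      rw [h.hactive]
      simp only [Finset.mem_sdiff, Finset.mem_univ, true_and, Finset.mem_union, not_or]
      exact ⟨fun x => hia.1 (h.acc_sub hjJ x), fun x => hia.2 (h.rej_sub hjJ x)⟩
    rcases Nat.lt_or_ge (h.t j) n with hn | hn
    · rcases Nat.lt_or_ge n (h.t (j + 1)) with hn2 | hn2
      · exact lt_of_le_of_lt (hL _) (h.hcont j hjJ n hn hn2 i hij).1
      · have : n = h.t (j + 1) := le_antisymm h2 hn2
        subst this
        by_cases hc : ∃ i ∈ h.active j, Λ i (h.t (j + 1)) ≤ lo (h.a j)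
        · obtain ⟨m, hm1, hmK, hor, _, e⟩ := h.haccept j hjJ hc
          obtain ⟨p, hp, rfl⟩ := h.exists_ord hjJ hij
          have hpm : m ≤ p := by
            by_contra hlt
            apply hia.1
            rw [e]
            apply Finset.mem_union_right
            exact Finset.mem_image_of_mem _ (Finset.mem_range.2 (by omega))
          rcases hor with hor | hor
          · omega
          · exact lt_of_le_of_lt (hL _) (lt_of_lt_of_le hor (h.hord_mono j hjJ m p hpm hp))
        · push Not at hc
          exact lt_of_le_of_lt (hL _) (hc i hij)
    · exact ih hjJ.le i hij n h1 hn

theorem HolmPath.key {k : ℕ} {lo hi : ℕ → ℝ} {Λ : Fin k → ℕ → ℝ}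
    (h : HolmPath k lo hi Λ) (L : ℝ) (hL : ∀ a, L ≤ lo a) (hhi : Antitone hi)
    (T : Finset (Fin k)) (hrej : ∃ i ∈ T, i ∈ h.rej h.J) :
    ∃ i ∈ T, ∃ n, 1 ≤ n ∧ hi (k - T.card) ≤ Λ i n ∧
      ∀ n', 1 ≤ n' → n' < n → L < Λ i n' := by
  classical
  have hex : ∃ j, j ≤ h.J ∧ ∃ i ∈ T, i ∈ h.rej j := ⟨h.J, le_rfl, hrej⟩
  obtain ⟨hjJ, i₁, hi₁T, hi₁⟩ := Nat.find_spec hex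
  have hmin := fun m => Nat.find_min hex (m := m)
  generalize Nat.find hex = j' at hjJ hi₁ hmin
  cases j' with
  | zero => simp [h.hrej0] at hi₁
  | succ j =>
  have hj : j < h.J := hjJ
  have hnone : ∀ i ∈ h.rej j, i ∉ T := fun i hir hiT =>
    hmin j (Nat.lt_succ_self j) ⟨hj.le, i, hiT, hir⟩
  have hc : ∃ i ∈ h.active j, hi (h.r j) ≤ Λ i (h.t (j + 1)) := by
    by_contra hc
    rw [h.hnoreject j hj hc] at hi₁
    exact hnone _ hi₁ hi₁T
  obtain ⟨m, hm1, hmK, _, hm', e⟩ := h.hreject j hj hc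
  rw [e] at hi₁
  have hexq : ∃ q, 1 ≤ q ∧ q ≤ m ∧ h.ord j (h.K j - q) ∈ T := by
    rcases Finset.mem_union.1 hi₁ with hi₁ | hi₁
    · exact absurd hi₁T (hnone _ hi₁)
    · obtain ⟨p, hp, rfl⟩ := Finset.mem_image.1 hi₁
      rw [Finset.mem_Ico] at hp
      refine ⟨h.K j - p, by omega, by omega, ?_⟩
      rwa [show h.K j - (h.K j - p) = p by omega]
  obtain ⟨hq1, hqm, hqT⟩ := Nat.find_spec hexq
  have hqmin := fun m => Nat.find_min hexq (m := m)
  generalize Nat.find hexq = q at hq1 hqm hqT hqmin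
  have hact := h.hord_mem j hj (h.K j - q) (by omega)
  have htj := h.htmono j hj
  refine ⟨_, hqT, h.t (j + 1), by omega, ?_, ?_⟩
  · have hcard : h.r j + (q - 1) ≤ k - T.card := by
      have hinj : Set.InjOn (h.ord j) (Finset.Ico (h.K j - q + 1) (h.K j) : Set ℕ) := by
        intro p hp p' hp' e
        simp at hp hp'
        exact h.hord_inj j hj p hp.2 p' hp'.2 e
      have hdisj : Disjoint (h.rej j) ((Finset.Ico (h.K j - q + 1) (h.K j)).image (h.ord j)) := by
        rw [Finset.disjoint_left]
        intro x hx hx'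
        obtain ⟨p, hp, rfl⟩ := Finset.mem_image.1 hx'
        have := h.hord_mem j hj p (Finset.mem_Ico.1 hp).2
        rw [h.hactive] at this
        simp [hx] at this
      have hsub : h.rej j ∪ (Finset.Ico (h.K j - q + 1) (h.K j)).image (h.ord j) ⊆ Tᶜ := by
        intro x hx
        rw [Finset.mem_compl]
        rcases Finset.mem_union.1 hx with hx | hx
        · exact hnone x hx
        · obtain ⟨p, hp, rfl⟩ := Finset.mem_image.1 hx
          rw [Finset.mem_Ico] at hp
          intro hT
          refine hqmin (h.K j - p) (by omega) ⟨by omega, by omega, ?_⟩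
          rwa [show h.K j - (h.K j - p) = p by omega]
      have := Finset.card_le_card hsub
      rw [Finset.card_union_of_disjoint hdisj, Finset.card_image_of_injOn hinj, Nat.card_Ico,
        Finset.card_compl, Fintype.card_fin, ← h.hr j] at this
      omega
    refine le_trans (hhi hcard) ?_
    rcases Nat.lt_or_ge 1 q with hq | hq
    · have := hm' (q - 1) (by omega) (by omega)
      push Not at this
      have := this.2
      rwa [show h.K j - (q - 1) - 1 = h.K j - q by omega] at this
    · have hq : q = 1 := by omega
      subst hq
      obtain ⟨i₀, hi₀, hle⟩ := hc
      obtain ⟨p, hp, rfl⟩ := h.exists_ord hj hi₀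
      exact le_trans hle (h.hord_mono j hj p _ (by omega) (by omega))
  · intro n hn1 hn2
    rcases Nat.lt_or_ge (h.t j) n with hn | hn
    · exact lt_of_le_of_lt (hL _) (h.hcont j hj n hn hn2 _ hact).1
    · exact h.active_lower L hL j hj.le _ hact n hn1 hn

/-- the reflected path -/
def HolmPath.refl' {k : ℕ} {lo hi : ℕ → ℝ} {Λ : Fin k → ℕ → ℝ}
    (h : HolmPath k lo hi Λ) :
    HolmPath k (fun a => -hi a) (fun r => -lo r) (fun i n => -Λ i n) where
  J := h.J
  t := h.t
  acc := h.rej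
  rej := h.acc
  active := h.active
  a := h.r
  r := h.a
  K := h.K
  ord j p := h.ord j (h.K j - 1 - p)
  ht0 := h.ht0
  hacc0 := h.hrej0
  hrej0 := h.hacc0
  hactive j := by rw [h.hactive, Finset.union_comm]
  ha := h.hr
  hr := h.ha
  hK := h.hK
  htmono := h.htmono
  hcont j hj n h1 h2 i hi := by
    have := h.hcont j hj n h1 h2 i hi
    exact ⟨neg_lt_neg this.2, neg_lt_neg this.1⟩
  hcross j hj := by
    obtain ⟨i, hi, hc⟩ := h.hcross j hj
    exact ⟨i, hi, hc.symm.imp neg_le_neg neg_le_neg⟩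
  hord_mem j hj p hp := h.hord_mem j hj _ (by omega)
  hord_inj j hj p hp q hq e := by
    have := h.hord_inj j hj _ (by omega) _ (by omega) e
    omega
  hord_mono j hj p q hpq hq := neg_le_neg (h.hord_mono j hj _ _ (by omega) (by omega))
  haccept j hj hc := by
    simp only [neg_le_neg_iff, neg_lt_neg_iff] at hc ⊢
    obtain ⟨m, h1, h2, h3, h4, h5⟩ := h.hreject j hj hc
    refine ⟨m, h1, h2, ?_, ?_, ?_⟩
    · rwa [show h.K j - 1 - m = h.K j - m - 1 by omega]
    · intro m' a b
      rw [show h.K j - 1 - m' = h.K j - m' - 1 by omega]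
      exact h4 m' a b
    · rw [h5]
      congr 1
      ext x
      simp only [Finset.mem_image, Finset.mem_Ico, Finset.mem_range]
      constructor
      · rintro ⟨p, hp, rfl⟩
        exact ⟨h.K j - 1 - p, by omega, by congr 1; omega⟩
      · rintro ⟨p, hp, rfl⟩
        exact ⟨h.K j - 1 - p, by omega, rfl⟩
  hnoaccept j hj hc := by
    simp only [neg_le_neg_iff] at hc
    exact h.hnoreject j hj hc
  hreject j hj hc := by
    simp only [neg_le_neg_iff, neg_lt_neg_iff] at hc ⊢
    obtain ⟨m, h1, h2, h3, h4, h5⟩ := h.haccept j hj hc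
    refine ⟨m, h1, h2, ?_, ?_, ?_⟩
    · rcases h3 with h3 | h3
      · exact Or.inl h3
      · by_cases hm : m = h.K j
        · exact Or.inl hm
        · rw [show h.K j - 1 - (h.K j - m - 1) = m by omega]
          exact Or.inr h3
    · intro m' a b
      rw [show h.K j - 1 - (h.K j - m' - 1) = m' by omega]
      exact h4 m' a b
    · rw [h5]
      congr 1
      ext x
      simp only [Finset.mem_image, Finset.mem_Ico, Finset.mem_range]
      constructor
      · rintro ⟨p, hp, rfl⟩
        exact ⟨h.K j - 1 - p, by omega, by congr 1; omega⟩
      · rintro ⟨p, hp, rfl⟩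
        exact ⟨h.K j - 1 - p, by omega, rfl⟩
  hnoreject j hj hc := by
    simp only [neg_le_neg_iff] at hc
    exact h.hnoaccept j hj hc
  hfinal := by
    rcases h.hfinal with hf | hf
    · exact Or.inl hf
    · refine Or.inr fun n hn i hi => ?_
      have := hf n hn i hi
      exact ⟨neg_lt_neg this.2, neg_lt_neg this.1⟩

theorem holm_mono_aux (k : ℕ) (hk : 2 ≤ k) (A : ℕ → ℝ)
    (hA : ∀ s, 1 ≤ s → s < k → A s ≤ A (s + 1)) : Monotone (fun a => A (min (a + 1) k)) := by
  apply monotone_nat_of_le_succ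
  intro n
  rcases Nat.lt_or_ge (n + 1) k with h | h
  ·
    rw [min_eq_left h.le, min_eq_left (by omega)]
    exact hA _ (by omega) h
  ·
    rw [min_eq_right h, min_eq_right (by omega)]

theorem holm_half {Ω : Type*} [MeasurableSpace Ω]
    (P : Measure Ω) (k : ℕ) (hk : 2 ≤ k) (α : ℝ) (hα : 0 < α)
    (Λ : Fin k → ℕ → Ω → ℝ) (A B : ℕ → ℝ)
    (hAmono : ∀ s, 1 ≤ s → s < k → A s ≤ A (s + 1))
    (hBmono : ∀ s, 1 ≤ s → s < k → B (s + 1) ≤ B s)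
    (T : Finset (Fin k))
    (hI : ∀ i ∈ T, ∀ s : ℕ, 1 ≤ s → s ≤ k →
      P {ω | ∃ n, 1 ≤ n ∧ B s ≤ Λ i n ω ∧
          ∀ n', 1 ≤ n' → n' < n → A 1 < Λ i n' ω}
        ≤ ENNReal.ofReal (α / ((k : ℝ) - s + 1)))
    (run : ∀ ω : Ω, HolmPath k (fun a => A (min (a + 1) k)) (fun r => B (min (r + 1) k))
      (fun i n => Λ i n ω)) :
    P {ω | ∃ i ∈ T, i ∈ (run ω).rej (run ω).J} ≤ ENNReal.ofReal α := by
  rcases T.eq_empty_or_nonempty with rfl | hT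
  · simp
  have hT0 : 1 ≤ T.card := hT.card_pos
  have hTk : T.card ≤ k := by simpa using Finset.card_le_univ T
  have hAm := holm_mono_aux k hk A hAmono
  have hBm : Antitone (fun r => B (min (r + 1) k)) := by
    have := (holm_mono_aux k hk (fun s => -B s) (fun s a b => neg_le_neg (hBmono s a b)))
    intro x y hxy
    exact neg_le_neg_iff.1 (this hxy)
  have hsub : {ω | ∃ i ∈ T, i ∈ (run ω).rej (run ω).J} ⊆
      ⋃ i ∈ T, {ω | ∃ n, 1 ≤ n ∧ B (k - T.card + 1) ≤ Λ i n ω ∧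
          ∀ n', 1 ≤ n' → n' < n → A 1 < Λ i n' ω} := by
    intro ω hω
    obtain ⟨i, hi, hn⟩ := (run ω).key (A 1) (fun a => by
      have := hAm (Nat.zero_le a)
      simp only at this
      rwa [min_eq_left (by omega)] at this) hBm T hω
    simp only [Set.mem_iUnion]
    refine ⟨i, hi, ?_⟩
    skip
    rwa [min_eq_left (by omega)] at hn
  calc _ ≤ _ := measure_mono hsub
    _ ≤ ∑ i ∈ T, _ := measure_biUnion_finset_le _ _
    _ ≤ ∑ i ∈ T, ENNReal.ofReal (α / T.card) := by
      apply Finset.sum_le_sum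
      intro i hi
      have := hI i hi (k - T.card + 1) (by omega) (by omega)
      refine this.trans (le_of_eq ?_)
      congr 2
      push_cast [Nat.cast_sub hTk]
      ring
    _ = ENNReal.ofReal α := by
      rw [Finset.sum_const, nsmul_eq_mul, ← ENNReal.ofReal_natCast,
        ← ENNReal.ofReal_mul (by positivity)]
      congr 1
      have : (T.card : ℝ) ≠ 0 := by positivity
      field_simp

/-- Under a common set of critical values `A₁ ≤ … ≤ A_k < B_k ≤ … ≤ B₁` for all streams, the
unstandardized sequential Holm procedure (continuation region `A_{a+1} < Λ < B_{r+1}` when `a`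
hypotheses have been accepted and `r` rejected, with the convention `A_{k+1} = A_k`,
`B_{k+1} = B_k`) controls both familywise error rates: if `k ≥ 2`, `α, β ∈ (0,1)`, the
statistics of the streams with true null hypotheses (`i ∈ T`) satisfy
`P(∃n: Λ i n ≥ B_s, Λ i n′ > A₁ ∀n′ < n) ≤ α/(k−s+1)` for all `s ∈ {1,…,k}`, and those with
false null hypotheses (`i ∈ F`) satisfy `P(∃n: Λ i n ≤ A_s, Λ i n′ < B₁ ∀n′ < n) ≤ β/(k−s+1)`
for all `s ∈ {1,…,k}`, then the probability that the procedure rejects `H⁽ⁱ⁾` for some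
`i ∈ T` is at most `α`, and the probability that it accepts `H⁽ⁱ⁾` for some `i ∈ F` is at
most `β`. -/
theorem seqHolm_unstandardized_FWER {Ω : Type*} [MeasurableSpace Ω]
    (P : Measure Ω) [IsProbabilityMeasure P]
    (k : ℕ) (hk : 2 ≤ k) (α β : ℝ)
    (hα : α ∈ Set.Ioo (0 : ℝ) 1) (hβ : β ∈ Set.Ioo (0 : ℝ) 1)
    (Λ : Fin k → ℕ → Ω → ℝ) (hmeas : ∀ i n, Measurable (Λ i n))
    (A B : ℕ → ℝ)
    (hAmono : ∀ s, 1 ≤ s → s < k → A s ≤ A (s + 1))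
    (hAB : A k < B k)
    (hBmono : ∀ s, 1 ≤ s → s < k → B (s + 1) ≤ B s)
    (T F : Finset (Fin k)) (hTF : Disjoint T F)
    (hI : ∀ i ∈ T, ∀ s : ℕ, 1 ≤ s → s ≤ k →
      P {ω | ∃ n, 1 ≤ n ∧ B s ≤ Λ i n ω ∧
          ∀ n', 1 ≤ n' → n' < n → A 1 < Λ i n' ω}
        ≤ ENNReal.ofReal (α / ((k : ℝ) - s + 1)))
    (hII : ∀ i ∈ F, ∀ s : ℕ, 1 ≤ s → s ≤ k →
      P {ω | ∃ n, 1 ≤ n ∧ Λ i n ω ≤ A s ∧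
          ∀ n', 1 ≤ n' → n' < n → Λ i n' ω < B 1}
        ≤ ENNReal.ofReal (β / ((k : ℝ) - s + 1)))
    (run : ∀ ω : Ω, HolmPath k (fun a => A (min (a + 1) k)) (fun r => B (min (r + 1) k))
      (fun i n => Λ i n ω)) :
    P {ω | ∃ i ∈ T, i ∈ (run ω).rej (run ω).J} ≤ ENNReal.ofReal α ∧
    P {ω | ∃ i ∈ F, i ∈ (run ω).acc (run ω).J} ≤ ENNReal.ofReal β := by
  refine ⟨holm_half P k hk α hα.1 Λ A B hAmono hBmono T hI run, ?_⟩
  exact holm_half P k hk β hβ.1 (fun i n ω => -Λ i n ω) (fun s => -B s) (fun s => -A s)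
    (fun s a b => neg_le_neg (hBmono s a b)) (fun s a b => neg_le_neg (hAmono s a b)) F
    (by simpa only [neg_le_neg_iff, neg_lt_neg_iff] using hII) (fun ω => (run ω).refl')
end

section
/- If additionally α + β < 1, then the sequential Holm critical values are properly ordered: A₁ ≤ A₂ ≤ … ≤ A_k < B_k ≤ B_{k−1} ≤ … ≤ B₁. -/
/-- `α_s = ((k−s+1−β)α)/((k−s+1)(k−β))`. -/
noncomputable def alphaS (k : ℕ) (α β : ℝ) (s : ℕ) : ℝ :=
  ((k : ℝ) - s + 1 - β) * α / (((k : ℝ) - s + 1) * ((k : ℝ) - β))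

/-- `β_s = ((k−s+1−α)β)/((k−s+1)(k−α))`. -/
noncomputable def betaS (k : ℕ) (α β : ℝ) (s : ℕ) : ℝ :=
  ((k : ℝ) - s + 1 - α) * β / (((k : ℝ) - s + 1) * ((k : ℝ) - α))

/-- The sequential Holm lower critical value `A_s = log(β/((1−α_s)(k−s+1)))`. -/
noncomputable def holmA (k : ℕ) (α β : ℝ) (s : ℕ) : ℝ :=
  Real.log (β / ((1 - alphaS k α β s) * ((k : ℝ) - s + 1)))

/-- The sequential Holm upper critical value `B_s = log(((1−β_s)(k−s+1))/α)`. -/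
noncomputable def holmB (k : ℕ) (α β : ℝ) (s : ℕ) : ℝ :=
  Real.log ((1 - betaS k α β s) * ((k : ℝ) - s + 1) / α)

lemma holm_aux (K a b m : ℝ) (hm : 1 ≤ m) (hK : 0 < K - b) :
    (1 - (m - b) * a / (m * (K - b))) * m = m - (m - b) * (a / (K - b)) := by
  have : m ≠ 0 := by linarith
  field_simp

lemma holm_c (K a b : ℝ) (hK : 2 ≤ K) (ha : 0 < a) (hb : b < 1) :
    0 < a / (K - b) ∧ a / (K - b) < a := by
  have h : 1 < K - b := by linarith
  exact ⟨by positivity, div_lt_self ha h⟩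

lemma holm_pos (m b c a : ℝ) (hm : 1 ≤ m) (hb : 0 < b) (hb1 : b < 1) (hc : 0 < c) (hca : c < a)
    (ha : a < 1) : 1 - a < m - (m - b) * c := by
  nlinarith [mul_nonneg (sub_nonneg.2 hm) (by linarith : 0 ≤ 1 - c), mul_pos hb hc]

/-- If `k ≥ 2`, `α, β ∈ (0,1)` and additionally `α + β < 1`, then the sequential Holm
critical values are properly ordered: `A₁ ≤ A₂ ≤ … ≤ A_k < B_k ≤ B_{k−1} ≤ … ≤ B₁`. -/
theorem holm_critical_values_ordered (k : ℕ) (hk : 2 ≤ k) (α β : ℝ)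
    (hα : α ∈ Set.Ioo (0 : ℝ) 1) (hβ : β ∈ Set.Ioo (0 : ℝ) 1) (hαβ : α + β < 1) :
    (∀ s, 1 ≤ s → s < k → holmA k α β s ≤ holmA k α β (s + 1)) ∧
    holmA k α β k < holmB k α β k ∧
    (∀ s, 1 ≤ s → s < k → holmB k α β (s + 1) ≤ holmB k α β s) := by
  obtain ⟨ha0, ha1⟩ := hα
  obtain ⟨hb0, hb1⟩ := hβ
  have hK : (2 : ℝ) ≤ k := by exact_mod_cast hk
  obtain ⟨c0, ca⟩ := holm_c k α β hK ha0 hb1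
  obtain ⟨d0, db⟩ := holm_c k β α hK hb0 ha1
  have hA : ∀ s : ℕ, s ≤ k → holmA k α β s =
      Real.log (β / (((k : ℝ) - s + 1) - (((k : ℝ) - s + 1) - β) * (α / (k - β)))) := by
    intro s hs
    have hs' : (s : ℝ) ≤ k := by exact_mod_cast hs
    rw [holmA, alphaS, holm_aux _ _ _ _ (by linarith) (by linarith)]
  have hB : ∀ s : ℕ, s ≤ k → holmB k α β s =
      Real.log ((((k : ℝ) - s + 1) - (((k : ℝ) - s + 1) - α) * (β / (k - α))) / α) := by
    intro s hs
    have hs' : (s : ℝ) ≤ k := by exact_mod_cast hs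
    rw [holmB, betaS, holm_aux _ _ _ _ (by linarith) (by linarith)]
  have pA : ∀ s : ℕ, s ≤ k →
      1 - α < ((k : ℝ) - s + 1) - (((k : ℝ) - s + 1) - β) * (α / (k - β)) := by
    intro s hs
    have hs' : (s : ℝ) ≤ k := by exact_mod_cast hs
    exact holm_pos _ _ _ _ (by linarith) hb0 hb1 c0 ca ha1
  have pB : ∀ s : ℕ, s ≤ k →
      1 - β < ((k : ℝ) - s + 1) - (((k : ℝ) - s + 1) - α) * (β / (k - α)) := by
    intro s hs
    have hs' : (s : ℝ) ≤ k := by exact_mod_cast hs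
    exact holm_pos _ _ _ _ (by linarith) ha0 ha1 d0 db hb1
  refine ⟨fun s _ hs => ?_, ?_, fun s _ hs => ?_⟩
  · rw [hA s hs.le, hA (s + 1) hs]
    have p1 := pA s hs.le
    have p2 := pA (s + 1) hs
    apply Real.log_le_log (div_pos hb0 (by linarith))
    apply div_le_div_of_nonneg_left hb0.le (by linarith)
    push_cast
    nlinarith
  · rw [hA k le_rfl, hB k le_rfl]
    have p1 := pA k le_rfl
    have p2 := pB k le_rfl
    apply Real.log_lt_log (div_pos hb0 (by linarith))
    exact ((div_lt_one (by linarith)).2 (by linarith)).trans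
      ((one_lt_div ha0).2 (by linarith))
  · rw [hB s hs.le, hB (s + 1) hs]
    have p2 := pB (s + 1) hs
    apply Real.log_le_log (div_pos (by linarith) ha0)
    apply div_le_div_of_nonneg_right _ ha0.le
    push_cast
    nlinarith
end

section
/- At any stage of the sequential Holm procedure, no null hypothesis can be both accepted and rejected: with the notation in the context, if x₁ ≤ −(k−a) (so at least one acceptance occurs) and x_K ≥ k−r (so at least one rejection occurs), then m + m′ ≤ K, i.e. the set of the m smallest-indexed (accepted) hypotheses and the set of the m′ largest-indexed (rejected) hypotheses are disjoint. -/
/-- At any stage of the sequential Holm procedure, no null hypothesis can be both accepted and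
rejected.  Here `k` is the total number of hypotheses, `a` (resp. `r`) the number previously
accepted (resp. rejected), `K = k − a − r ≥ 1` the number of active hypotheses, and
`x 1 ≤ … ≤ x K` the ordered values of the active standardized statistics at the stopping time
of the current stage.  `m` is the least `m′′ ∈ {1,…,K}` with `x_{m′′+1} > −(k−a−m′′)`
(convention `x_{K+1} = +∞`), and `m′` the least `m′′ ∈ {1,…,K}` with `x_{K−m′′} < k−r−m′′`
(convention `x₀ = −∞`).  If at least one acceptance occurs (`x 1 ≤ −(k−a)`) and at least one
rejection occurs (`x K ≥ k−r`), then `m + m′ ≤ K`: the `m` accepted and `m′` rejected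
hypotheses are disjoint. -/
theorem holm_no_conflict (k a r K : ℕ) (hk : 1 ≤ k) (hK : 1 ≤ K) (hsum : a + r + K = k)
    (x : ℕ → ℝ) (hmono : ∀ p q, 1 ≤ p → p ≤ q → q ≤ K → x p ≤ x q)
    (m m' : ℕ)
    (hm1 : 1 ≤ m) (hmK : m ≤ K)
    (hm_mem : m = K ∨ -((k : ℝ) - a - m) < x (m + 1))
    (hm_min : ∀ m'', 1 ≤ m'' → m'' ≤ K →
      (m'' = K ∨ -((k : ℝ) - a - m'') < x (m'' + 1)) → m ≤ m'')
    (hm'1 : 1 ≤ m') (hm'K : m' ≤ K)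
    (hm'_mem : m' = K ∨ x (K - m') < (k : ℝ) - r - m')
    (hm'_min : ∀ m'', 1 ≤ m'' → m'' ≤ K →
      (m'' = K ∨ x (K - m'') < (k : ℝ) - r - m'') → m' ≤ m'')
    (hacc : x 1 ≤ -((k : ℝ) - a)) (hrej : (k : ℝ) - r ≤ x K) :
    m + m' ≤ K := by
  have hk' : (a : ℝ) + r + K = k := by exact_mod_cast hsum
  have ha : (0 : ℝ) ≤ a := Nat.cast_nonneg a
  have hr : (0 : ℝ) ≤ r := Nat.cast_nonneg r
  have hmR : (m : ℝ) ≤ K := by exact_mod_cast hmK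
  have hmR' : (m' : ℝ) ≤ K := by exact_mod_cast hm'K
  have hKR : (1 : ℝ) ≤ K := by exact_mod_cast hK
  have h1 : x m < 0 := by
    rcases Nat.lt_or_ge 1 m with h | h
    · obtain ⟨n, rfl⟩ : ∃ n, m = n + 1 := ⟨m - 1, by omega⟩
      by_contra hc
      push_cast at hmR
      have := hm_min n (by omega) (by omega) (Or.inr (by linarith))
      omega
    · obtain rfl : m = 1 := by omega
      linarith
  have h2 : 0 < x (K - m' + 1) := by
    rcases Nat.lt_or_ge 1 m' with h | h
    · obtain ⟨n, rfl⟩ : ∃ n, m' = n + 1 := ⟨m' - 1, by omega⟩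
      by_contra hc
      push_cast at hmR'
      have e : K - (n + 1) + 1 = K - n := by omega
      rw [e] at hc
      have := hm'_min n (by omega) (by omega) (Or.inr (by linarith))
      omega
    · obtain rfl : m' = 1 := by omega
      have e : K - 1 + 1 = K := by omega
      rw [e]
      linarith
  by_contra hc
  have := hmono (K - m' + 1) m (by omega) (by omega) hmK
  linarith
end

section
/- If B ≥ 0 and Λ ≥ B, then the t-statistic satisfies T̃ ≥ √((n−1)(e^{(B/n)²}−1)). (This is the pathwise inclusion {Λ^(i)(n) ≥ B} ⊆ {T̃_n ≥ b_n} used in the proof of the sequential t-test lemma.) -/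
/-- Fix `n ≥ 2`, `δ > 0`, `σ̂ > 0` and `x̄ ∈ ℝ`, and let
`Λ = n·√(log(1 + (x̄/σ̂)²))` if `x̄ ≥ δ/2` and `Λ = −n·√(log(1 + ((x̄−δ)/σ̂)²))` otherwise,
and `T̃ = √(n−1)·x̄/σ̂`.  If `B ≥ 0` and `Λ ≥ B`, then `T̃ ≥ √((n−1)(e^{(B/n)²}−1))`. -/
theorem t_stat_upper_crossing (n : ℕ) (hn : 2 ≤ n) (δ σhat xbar : ℝ)
    (hδ : 0 < δ) (hσ : 0 < σhat) (B : ℝ) (hB : 0 ≤ B)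
    (hΛ : B ≤ (if δ / 2 ≤ xbar then
        (n : ℝ) * Real.sqrt (Real.log (1 + (xbar / σhat) ^ 2))
      else
        -((n : ℝ) * Real.sqrt (Real.log (1 + ((xbar - δ) / σhat) ^ 2))))) :
    Real.sqrt (((n : ℝ) - 1) * (Real.exp ((B / n) ^ 2) - 1)) ≤
      Real.sqrt ((n : ℝ) - 1) * xbar / σhat := by
  have hn0 : (0 : ℝ) < n := by
    have : 0 < n := by omega
    exact_mod_cast this
  have hn1 : (0 : ℝ) ≤ (n : ℝ) - 1 := by
    have : (2 : ℝ) ≤ n := by exact_mod_cast hn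
    linarith
  split_ifs at hΛ with h
  · have hx : 0 < xbar := by linarith
    have hy : 0 < xbar / σhat := div_pos hx hσ
    have h1 : B / n ≤ Real.sqrt (Real.log (1 + (xbar / σhat) ^ 2)) := by
      rw [div_le_iff₀ hn0]
      linarith
    have hlog : 0 ≤ Real.log (1 + (xbar / σhat) ^ 2) :=
      Real.log_nonneg (by nlinarith [sq_nonneg (xbar / σhat)])
    have h2 : (B / n) ^ 2 ≤ Real.log (1 + (xbar / σhat) ^ 2) := by
      have h3 := pow_le_pow_left₀ (div_nonneg hB hn0.le) h1 2
      rwa [Real.sq_sqrt hlog] at h3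
    have h4 : Real.exp ((B / n) ^ 2) ≤ 1 + (xbar / σhat) ^ 2 :=
      (Real.le_log_iff_exp_le (by positivity)).1 h2
    rw [Real.sqrt_mul hn1, mul_div_assoc]
    refine mul_le_mul_of_nonneg_left ?_ (Real.sqrt_nonneg _)
    exact Real.sqrt_le_iff.2 ⟨hy.le, by linarith⟩
  · exfalso
    have hne : (xbar - δ) / σhat ≠ 0 :=
      div_ne_zero (by intro h0; apply h; linarith) hσ.ne'
    have hpos : 0 < ((xbar - δ) / σhat) ^ 2 := by positivity
    have hlog : 0 < Real.log (1 + ((xbar - δ) / σhat) ^ 2) :=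
      Real.log_pos (by linarith)
    have := mul_pos hn0 (Real.sqrt_pos.2 hlog)
    linarith
end

section
/- If A ≤ 0 and Λ > A, then the t-statistic satisfies T̃ > −√((n−1)(e^{(A/n)²}−1)). (This is the pathwise inclusion {Λ^(i)(n) > A} ⊆ {T̃_n > a_n} used in the proof of the sequential t-test lemma.) -/
/-- Fix `n ≥ 2`, `δ > 0`, `σ̂ > 0` and `x̄ ∈ ℝ`, and let
`Λ = n·√(log(1 + (x̄/σ̂)²))` if `x̄ ≥ δ/2` and `Λ = −n·√(log(1 + ((x̄−δ)/σ̂)²))` otherwise,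
and `T̃ = √(n−1)·x̄/σ̂`.  If `A ≤ 0` and `Λ > A`, then `T̃ > −√((n−1)(e^{(A/n)²}−1))`. -/
theorem t_stat_lower_noncrossing (n : ℕ) (hn : 2 ≤ n) (δ σhat xbar : ℝ)
    (hδ : 0 < δ) (hσ : 0 < σhat) (A : ℝ) (hA : A ≤ 0)
    (hΛ : A < (if δ / 2 ≤ xbar then
        (n : ℝ) * Real.sqrt (Real.log (1 + (xbar / σhat) ^ 2))
      else
        -((n : ℝ) * Real.sqrt (Real.log (1 + ((xbar - δ) / σhat) ^ 2))))) :
    -Real.sqrt (((n : ℝ) - 1) * (Real.exp ((A / n) ^ 2) - 1)) <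
      Real.sqrt ((n : ℝ) - 1) * xbar / σhat := by
  have hn1 : (2 : ℝ) ≤ n := by exact_mod_cast hn
  have hn0 : (0 : ℝ) < n := by linarith
  have hm : (0 : ℝ) < (n : ℝ) - 1 := by linarith
  have hs : 0 < Real.sqrt ((n : ℝ) - 1) := Real.sqrt_pos.mpr hm
  rcases lt_or_ge 0 xbar with hx | hx
  · have h1 : 0 < Real.sqrt ((n : ℝ) - 1) * xbar / σhat := by positivity
    have h2 := Real.sqrt_nonneg (((n : ℝ) - 1) * (Real.exp ((A / n) ^ 2) - 1))
    linarith
  · rw [if_neg (by linarith)] at hΛ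
    have h1 : Real.sqrt (Real.log (1 + ((xbar - δ) / σhat) ^ 2)) < -A / n := by
      rw [lt_div_iff₀ hn0]
      linarith
    have hpos : 0 < -A / n := lt_of_le_of_lt (Real.sqrt_nonneg _) h1
    rw [Real.sqrt_lt' hpos, Real.log_lt_iff_lt_exp (by positivity)] at h1
    have h2 : (-A / (n : ℝ)) ^ 2 = (A / n) ^ 2 := by ring
    rw [h2] at h1
    have h3 : (-(xbar / σhat)) ^ 2 ≤ ((xbar - δ) / σhat) ^ 2 := by
      rw [neg_sq, div_pow, div_pow]
      apply div_le_div_of_nonneg_right _ (by positivity)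
      nlinarith
    have h4 : -(xbar / σhat) < Real.sqrt (Real.exp ((A / n) ^ 2) - 1) := by
      apply Real.lt_sqrt_of_sq_lt
      linarith
    rw [Real.sqrt_mul hm.le, mul_div_assoc]
    nlinarith [mul_lt_mul_of_pos_left h4 hs]
end
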